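/- arXiv:2506.14360 — 4 statements merged into one kernel-verified Lean document; each statement's English description precedes it below -/
import Mathlib

section
/- Fix constants A > 0, D > 0, L_R > 0, and for each channel use t ∈ {1,…,n} let the absorbing probability be λ̃_t = erfc(L_R/(2√(D t))) ∈ (0,1). For every rate R < 1/4 and every pair of error thresholds λ₁, λ₂ ∈ (0,1), for all sufficiently large n there exists a family {(u_i, D_i) : i ∈ {1,…,N}} with N ≥ 2^{R · n · log₂ n}, where each codeword u_i ∈ [0,A]^n and each decoding region D_i ⊆ ℕ^n, such that if Y^n = (Y_1,…,Y_n) has independent coordinates with Y_t Poisson-distributed with mean λ̃_t · u_{i,t}, then P(Y^n ∉ D_i) ≤ λ₁ for every i, and P(Y^n ∈ D_j) ≤ λ₂ for every j ≠ i. (In other words, the deterministic identification capacity, in the super-exponential scale log N / (n log n), of the diffusion-based discrete-time Poisson channel with peak molecule-release constraint A is at least 1/4.) -/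
open MeasureTheory ProbabilityTheory Real
open scoped ENNReal

/-- The complementary error function `erfc x = (2/√π) ∫_x^∞ e^{−s²} ds`. -/
noncomputable def erfc (x : ℝ) : ℝ :=
  (2 / Real.sqrt π) * ∫ s in Set.Ioi x, Real.exp (-s ^ 2)

/-- The absorbing probability of channel use `t ∈ {1, …, n}` (represented by `t : Fin n`,
channel use `t.val + 1`) for a receiver at distance `L_R` and diffusion coefficient `D`:
`λ̃_t = erfc (L_R / (2 √(D t)))`. -/
noncomputable def absorbProb (D L_R : ℝ) {n : ℕ} (t : Fin n) : ℝ :=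
  erfc (L_R / (2 * Real.sqrt (D * ((t : ℕ) + 1 : ℕ))))

/-- The law of the channel output on input codeword `u ∈ [0,A]^n`: `n` independent
coordinates, the `t`-th being Poisson with mean `λ̃_t · u_t`. -/
noncomputable def channelOutput (D L_R : ℝ) {n : ℕ} (u : Fin n → ℝ) :
    Measure (Fin n → ℕ) :=
  Measure.pi fun t : Fin n => poissonMeasure (absorbProb D L_R t * u t).toNNReal

section Helpers
open scoped NNReal Nat

lemma po_shift (r : ℝ≥0) (g : ℕ → ℝ) (S : ℝ)
    (h : HasSum (fun n : ℕ => (rexp (-r) * r ^ n / (n)! : ℝ) * g (n + 1)) S) :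
    HasSum (fun n : ℕ => (rexp (-r) * r ^ n / (n)! : ℝ) * (n * g n)) (r * S) := by
  rw [← hasSum_nat_add_iff' 1]
  have h2 := h.mul_left (r : ℝ)
  simp only [Finset.range_one, Finset.sum_singleton, Nat.cast_zero, zero_mul, mul_zero, sub_zero]
  convert! h2 using 2 with n
  rw [Nat.factorial_succ]
  push_cast
  have : ((n : ℝ) + 1) ≠ 0 := by positivity
  have : ((n)! : ℝ) ≠ 0 := by positivity
  field_simp
  ring

lemma po_exp (r : ℝ≥0) :
    HasSum (fun n : ℕ => (rexp (-r) * r ^ n / (n)! : ℝ) * rexp n) (rexp (-r) * rexp (r * rexp 1)) := by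
  have h := (NormedSpace.expSeries_div_hasSum_exp ((r : ℝ) * rexp 1)).mul_left (rexp (-r))
  rw [← Real.exp_eq_exp_ℝ] at h
  convert! h using 2 with n
  rw [mul_pow, ← Real.exp_nat_mul, mul_one]
  ring

/-- one-coordinate decoding statistic -/
noncomputable def stat (ν : ℝ) (y : ℕ) : ℝ := ((y : ℝ) - ν) ^ 2 - y

lemma po_mean (r : ℝ≥0) (ν : ℝ) : ∫ y, stat ν y ∂(poissonMeasure r) = ((r : ℝ) - ν) ^ 2 := by
  rw [integral_poissonMeasure]
  refine HasSum.tsum_eq ?_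
  have h0 := hasSum_one_poissonMeasure r
  have h1 : HasSum (fun n : ℕ => (rexp (-r) * r ^ n / (n)! : ℝ) * (n * (1 : ℝ))) (r * 1) :=
    po_shift r (fun _ => 1) 1 (by simpa using h0)
  have h2 : HasSum (fun n : ℕ => (rexp (-r) * r ^ n / (n)! : ℝ) * (n * (n : ℝ))) (r * (r * 1 + 1)) := by
    refine po_shift r (fun n => (n : ℝ)) _ ?_
    convert! h1.add h0 using 2 with n
    push_cast; ring
  convert! ((h2.add (h1.mul_left (-2 * ν - 1))).add (h0.mul_left (ν ^ 2))) using 1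
  · ext n; simp only [stat, smul_eq_mul]; ring
  · ring

lemma stat_sq_le (ν M : ℝ) (h0 : 0 ≤ ν) (hM : ν ≤ M) (y : ℕ) :
    stat ν y ^ 2 ≤ 24 * rexp (M + 1) * rexp y := by
  have hy : (0 : ℝ) ≤ y := Nat.cast_nonneg y
  have h1 : |stat ν y| ≤ ((y : ℝ) + M + 1) ^ 2 := by
    rw [abs_le]; unfold stat
    constructor <;> nlinarith [mul_nonneg hy h0, sq_nonneg ((y:ℝ) - ν), mul_nonneg hy (h0.trans hM), sq_nonneg M]
  have h2 := Real.pow_div_factorial_le_exp ((y : ℝ) + M + 1) (by linarith) 4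
  rw [div_le_iff₀ (by positivity)] at h2
  have h3 : rexp ((y : ℝ) + M + 1) = rexp (M + 1) * rexp y := by rw [← Real.exp_add]; ring_nf
  calc stat ν y ^ 2 = |stat ν y| ^ 2 := (sq_abs _).symm
    _ ≤ (((y : ℝ) + M + 1) ^ 2) ^ 2 := by gcongr
    _ = ((y : ℝ) + M + 1) ^ 4 := by ring
    _ ≤ _ := by rw [h3] at h2; norm_num [Nat.factorial] at h2; linarith

lemma po_exp_int (r : ℝ≥0) : Integrable (fun y : ℕ => rexp (y : ℝ)) (poissonMeasure r) := by
  rw [integrable_poissonMeasure_iff]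
  simpa [abs_of_pos (Real.exp_pos _)] using (po_exp r).summable

lemma stat_memLp (r : ℝ≥0) (ν : ℝ) (h0 : 0 ≤ ν) : MemLp (stat ν) 2 (poissonMeasure r) := by
  rw [memLp_two_iff_integrable_sq (by exact .of_discrete)]
  refine ((po_exp_int r).const_mul (24 * rexp (ν + 1))).mono' (by exact .of_discrete) (.of_forall fun y => ?_)
  rw [Real.norm_of_nonneg (sq_nonneg _)]
  exact stat_sq_le ν ν h0 le_rfl y

lemma stat_var (r : ℝ≥0) (ν M : ℝ) (h0 : 0 ≤ ν) (hM : ν ≤ M) (hr : (r : ℝ) ≤ M) :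
    variance (stat ν) (poissonMeasure r) ≤ 24 * rexp (M + 1) * rexp (M * rexp 1) := by
  refine (variance_le_expectation_sq (by exact .of_discrete)).trans ?_
  have h1 : ∫ y, (stat ν ^ 2) y ∂(poissonMeasure r) ≤ ∫ y : ℕ, 24 * rexp (M + 1) * rexp (y : ℝ) ∂(poissonMeasure r) := by
    refine integral_mono ((memLp_two_iff_integrable_sq (by exact .of_discrete)).1 (stat_memLp r ν h0)) ((po_exp_int r).const_mul _) fun y => ?_
    exact stat_sq_le ν M h0 hM y
  refine h1.trans ?_
  rw [integral_const_mul, integral_poissonMeasure]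
  simp only [smul_eq_mul]
  rw [(po_exp r).tsum_eq]
  gcongr
  have : rexp (-r) ≤ 1 := by rw [Real.exp_le_one_iff]; simp
  calc _ ≤ 1 * rexp (r * rexp 1) := by gcongr
    _ ≤ _ := by rw [one_mul]; gcongr

lemma cheb {n : ℕ} (r : Fin n → ℝ≥0) (ν : Fin n → ℝ) (M T : ℝ) (hT : 0 < T)
    (h0 : ∀ t, 0 ≤ ν t) (hM : ∀ t, ν t ≤ M) (hr : ∀ t, (r t : ℝ) ≤ M) :
    Measure.pi (fun t => poissonMeasure (r t))
      {y | T ≤ |(∑ t, stat (ν t) (y t)) - ∑ t, ((r t : ℝ) - ν t) ^ 2|} ≤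
      ENNReal.ofReal (n * (24 * rexp (M + 1) * rexp (M * rexp 1)) / T ^ 2) := by
  have hm : ∀ t, MemLp (fun y : Fin n → ℕ => stat (ν t) (y t)) 2 (Measure.pi (fun t => poissonMeasure (r t))) := fun t =>
    (stat_memLp (r t) (ν t) (h0 t)).comp_measurePreserving (measurePreserving_eval _ t)
  have hmean : ∫ y, (∑ t, stat (ν t) (y t)) ∂(Measure.pi (fun t => poissonMeasure (r t))) = ∑ t, ((r t : ℝ) - ν t) ^ 2 := by
    rw [integral_finsetSum _ (fun t _ => (hm t).integrable (by norm_num))]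
    refine Finset.sum_congr rfl fun t _ => ?_
    rw [integral_comp_eval (μ := fun t => poissonMeasure (r t)) (f := stat (ν t)) (by exact .of_discrete), po_mean]
  have hvar : variance (fun y => ∑ t, stat (ν t) (y t)) (Measure.pi (fun t => poissonMeasure (r t))) ≤ n * (24 * rexp (M + 1) * rexp (M * rexp 1)) := by
    have := variance_sum_pi (μ := fun t => poissonMeasure (r t)) (X := fun t => stat (ν t)) (fun t => stat_memLp (r t) (ν t) (h0 t))
    have e : (fun y : Fin n → ℕ => ∑ t, stat (ν t) (y t)) = ∑ t, fun y : Fin n → ℕ => stat (ν t) (y t) := by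
      ext y; simp
    rw [e, this]
    refine (Finset.sum_le_sum fun t _ => stat_var (r t) (ν t) M (h0 t) (hM t) (hr t)).trans ?_
    simp
  have hms : MemLp (fun y : Fin n → ℕ => ∑ t, stat (ν t) (y t)) 2 (Measure.pi (fun t => poissonMeasure (r t))) :=
    memLp_finsetSum _ (fun t _ => hm t)
  have := meas_ge_le_variance_div_sq hms hT
  rw [hmean] at this
  refine this.trans (ENNReal.ofReal_le_ofReal ?_)
  gcongr

/-- Gilbert-Varshamov. -/
lemma gv (n q d : ℕ) (hq : 0 < q) : ∃ C : Finset (Fin n → Fin q),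
    (∀ x ∈ C, ∀ y ∈ C, x ≠ y → d ≤ hammingDist x y) ∧ q ^ n ≤ C.card * (2 ^ n * q ^ d) := by
  classical
  obtain ⟨C, hC⟩ := Finset.exists_maximal
    (s := Finset.univ.filter fun C : Finset (Fin n → Fin q) => ∀ x ∈ C, ∀ y ∈ C, x ≠ y → d ≤ hammingDist x y)
    ⟨∅, by simp⟩
  have hC1 := hC.1
  simp only [Finset.mem_filter, Finset.mem_univ, true_and] at hC1
  refine ⟨C, hC1, ?_⟩
  have hball : ∀ x : Fin n → Fin q, (Finset.univ.filter fun y => hammingDist x y < d).card ≤ 2 ^ n * q ^ d := by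
    intro x
    have hsub : (Finset.univ.filter fun y => hammingDist x y < d) ⊆
        ((Finset.univ : Finset (Finset (Fin n))).filter (fun S => S.card < d)).biUnion
          (fun S => Finset.univ.filter fun y => ∀ t, t ∉ S → y t = x t) := by
      intro y hy
      simp only [Finset.mem_filter, Finset.mem_univ, true_and, Finset.mem_biUnion] at hy ⊢
      refine ⟨Finset.univ.filter fun t => x t ≠ y t, hy, fun t ht => ?_⟩
      simp at ht; exact ht.symm
    refine (Finset.card_le_card hsub).trans ?_
    refine (Finset.card_biUnion_le_card_mul _ _ (q ^ d) ?_).trans ?_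
    · intro S hS
      simp only [Finset.mem_filter, Finset.mem_univ, true_and] at hS
      have : (Finset.univ.filter fun y : Fin n → Fin q => ∀ t, t ∉ S → y t = x t).card ≤ (Finset.univ : Finset (S → Fin q)).card := by
        refine Finset.card_le_card_of_injOn (fun y t => y t) (by simp) ?_
        intro y hy z hz hyz
        simp at hy hz
        ext t
        by_cases ht : t ∈ S
        · exact congrArg Fin.val (congrFun hyz ⟨t, ht⟩)
        · rw [hy t ht, hz t ht]
      refine this.trans ?_
      simp
      exact Nat.pow_le_pow_right hq hS.le
    · gcongr
      refine (Finset.card_filter_le _ _).trans ?_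
      simp
  have hcov : (Finset.univ : Finset (Fin n → Fin q)) ⊆ C.biUnion (fun x => Finset.univ.filter fun y => hammingDist x y < d ∨ y = x) := by
    intro y _
    by_contra hy
    simp only [Finset.mem_biUnion, Finset.mem_filter, Finset.mem_univ, true_and, not_exists, not_and, not_or, not_lt] at hy
    have hmem : insert y C ∈ (Finset.univ.filter fun C : Finset (Fin n → Fin q) => ∀ x ∈ C, ∀ y ∈ C, x ≠ y → d ≤ hammingDist x y) := by
      simp only [Finset.mem_filter, Finset.mem_univ, true_and, Finset.mem_insert]
      rintro a (rfl | ha) b (rfl | hb) hab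
      · exact absurd rfl hab
      · rw [hammingDist_comm]; exact (hy b hb).1
      · exact (hy a ha).1
      · exact hC1 a ha b hb hab
    have := hC.2 hmem (Finset.subset_insert y C)
    exact (hy y (this (Finset.mem_insert_self y C))).2 rfl
  have hball' : ∀ x : Fin n → Fin q, (Finset.univ.filter fun y => hammingDist x y < d ∨ y = x).card ≤ 2 ^ n * q ^ d := by
    intro x
    rcases Nat.eq_zero_or_pos d with rfl | hd
    · simp [Finset.filter_eq']
      exact Nat.one_le_two_pow
    · convert! hball x using 4 with y
      constructor
      · rintro (h | rfl)
        · exact h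
        · simpa using hd
      · exact Or.inl
  have := (Finset.card_le_card hcov).trans (Finset.card_biUnion_le_card_mul _ _ _ fun x _ => hball' x)
  simpa using this

lemma gauss_int : Integrable (fun s : ℝ => rexp (-s ^ 2)) := by
  simpa using integrable_exp_neg_mul_sq (b := 1) one_pos

lemma erfc_pos (x : ℝ) : 0 < erfc x := by
  unfold erfc
  refine mul_pos (by positivity) ?_
  rw [setIntegral_pos_iff_support_of_nonneg_ae (.of_forall fun s => (Real.exp_pos _).le) gauss_int.integrableOn]
  have : Function.support (fun s : ℝ => rexp (-s ^ 2)) = Set.univ := by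
    ext s; simp [Real.exp_ne_zero]
  rw [this]; simp

lemma erfc_anti {x y : ℝ} (h : x ≤ y) : erfc y ≤ erfc x := by
  unfold erfc
  refine mul_le_mul_of_nonneg_left ?_ (by positivity)
  exact setIntegral_mono_set gauss_int.integrableOn (.of_forall fun s => (Real.exp_pos _).le)
    (Set.Ioi_subset_Ioi h).eventuallyLE

lemma absorb_bounds (D L_R : ℝ) (hD : 0 < D) (hL : 0 < L_R) {n : ℕ} (t : Fin n) :
    erfc (L_R / (2 * Real.sqrt D)) ≤ absorbProb D L_R t ∧ absorbProb D L_R t ≤ erfc 0 := by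
  unfold absorbProb
  constructor
  · apply erfc_anti
    have : 0 < Real.sqrt D := Real.sqrt_pos.2 hD
    gcongr
    push_cast
    nlinarith [Nat.cast_nonneg (α := ℝ) (t : ℕ)]
  · apply erfc_anti; positivity

lemma ev_rpow (s B : ℝ) (hs : 0 < s) : ∃ n₀ : ℕ, ∀ n ≥ n₀, B ≤ (n : ℝ) ^ s := by
  have := ((tendsto_rpow_atTop hs).comp tendsto_natCast_atTop_atTop).eventually_ge_atTop B
  obtain ⟨a, ha⟩ := Filter.eventually_atTop.1 this
  exact ⟨a, ha⟩

lemma sep_bound {n q d : ℕ} (hq : 0 < q) (A c : ℝ) (hA : 0 < A) (hc : 0 < c) (g : Fin n → ℝ)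
    (hg : ∀ t, c ≤ g t) (x y : Fin n → Fin q) (h : d ≤ hammingDist x y) :
    c ^ 2 * (A / q) ^ 2 * d ≤ ∑ t, (g t * (A * ((x t : ℕ) : ℝ) / q) - g t * (A * ((y t : ℕ) : ℝ) / q)) ^ 2 := by
  have hq' : (0 : ℝ) < q := by exact_mod_cast hq
  have h1 : ∀ t, (if x t ≠ y t then c ^ 2 * (A / q) ^ 2 else 0) ≤
      (g t * (A * ((x t : ℕ) : ℝ) / q) - g t * (A * ((y t : ℕ) : ℝ) / q)) ^ 2 := by
    intro t
    split_ifs with hne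
    · have hz : ((x t : ℕ) : ℤ) - ((y t : ℕ) : ℤ) ≠ 0 := by
        intro h0; apply hne; ext; omega
      have h2 : (1 : ℤ) ≤ (((x t : ℕ) : ℤ) - ((y t : ℕ) : ℤ)) ^ 2 := by
        have := sq_pos_of_ne_zero hz; omega
      have h3 : (1 : ℝ) ≤ (((x t : ℕ) : ℝ) - ((y t : ℕ) : ℝ)) ^ 2 := by exact_mod_cast h2
      have h4 : (g t * (A * ((x t : ℕ) : ℝ) / q) - g t * (A * ((y t : ℕ) : ℝ) / q)) ^ 2 =
          (g t) ^ 2 * (A / q) ^ 2 * (((x t : ℕ) : ℝ) - ((y t : ℕ) : ℝ)) ^ 2 := by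
        field_simp
      rw [h4]
      have h5 : c ^ 2 ≤ (g t) ^ 2 := by gcongr; exact hg t
      calc c ^ 2 * (A / q) ^ 2 = c ^ 2 * (A / q) ^ 2 * 1 := by ring
        _ ≤ _ := by gcongr
    · positivity
  refine le_trans ?_ (Finset.sum_le_sum fun t _ => h1 t)
  rw [← Finset.sum_filter, Finset.sum_const, nsmul_eq_mul, mul_comm]
  gcongr
  exact h

lemma size_bound (n N q d : ℕ) (R r θ : ℝ) (hn : 2 ≤ n) (hr : 0 < r) (hθ : 0 < θ) (hθ2 : 2 * θ < 1)
    (hq : (n : ℝ) ^ r ≤ q) (hd : (d : ℝ) ≤ 2 * θ * n)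
    (h : q ^ n ≤ N * (2 ^ n * q ^ d)) (hbig : (2 : ℝ) ≤ (n : ℝ) ^ (r * (1 - 2 * θ) - R)) :
    (2 : ℝ) ^ (R * (n : ℝ) * Real.logb 2 (n : ℝ)) ≤ N := by
  have hn0 : (0 : ℝ) < n := by positivity
  have hq0 : (0 : ℝ) < q := lt_of_lt_of_le (by positivity) hq
  have hN0 : 0 < N := by
    rcases Nat.eq_zero_or_pos N with rfl | h0
    · have : 0 < q ^ n := by have : 0 < q := by exact_mod_cast hq0
                             positivity
      omega
    · exact h0
  have hN : (0 : ℝ) < N := by exact_mod_cast hN0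
  have h' : (q : ℝ) ^ n ≤ N * (2 ^ n * q ^ d) := by exact_mod_cast h
  have h1 := Real.log_le_log (by positivity) h'
  rw [Real.log_mul (by positivity) (by positivity), Real.log_mul (by positivity) (by positivity),
    Real.log_pow, Real.log_pow, Real.log_pow] at h1
  have h2 := Real.log_le_log (by positivity) hq
  rw [Real.log_rpow hn0] at h2
  have h3 := Real.log_le_log (by positivity) hbig
  rw [Real.log_rpow hn0] at h3
  have hlogn : 0 < Real.log n := Real.log_pos (by exact_mod_cast hn)
  have hl2 : 0 < Real.log 2 := Real.log_pos (by norm_num)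
  have e : (2 : ℝ) ^ (R * (n : ℝ) * Real.logb 2 (n : ℝ)) = rexp (R * n * Real.log n) := by
    rw [Real.rpow_def_of_pos (by norm_num), Real.logb]
    congr 1; field_simp
  rw [e, ← Real.le_log_iff_exp_le hN]
  have h4 : (1 - 2 * θ) * n * (r * Real.log n) ≤ (n - d) * Real.log q := by
    refine mul_le_mul (by linarith) h2 (by positivity) ?_
    nlinarith
  nlinarith [mul_le_mul_of_nonneg_left h3 hn0.le]

end Helpers

theorem DI_capacity_diffusion_poisson_lower_bound (A D L_R : ℝ)
    (hA : 0 < A) (hD : 0 < D) (hL : 0 < L_R) :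
    ∀ R : ℝ, R < 1 / 4 →
      ∀ lam₁ lam₂ : ℝ, lam₁ ∈ Set.Ioo (0 : ℝ) 1 → lam₂ ∈ Set.Ioo (0 : ℝ) 1 →
        ∃ n₀ : ℕ, ∀ n ≥ n₀,
          ∃ (N : ℕ) (u : Fin N → Fin n → ℝ) (Dec : Fin N → Set (Fin n → ℕ)),
            (2 : ℝ) ^ (R * (n : ℝ) * Real.logb 2 (n : ℝ)) ≤ (N : ℝ) ∧
            (∀ i t, u i t ∈ Set.Icc 0 A) ∧
            (∀ i, channelOutput D L_R (u i) (Dec i)ᶜ ≤ ENNReal.ofReal lam₁) ∧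
            (∀ i j, i ≠ j → channelOutput D L_R (u i) (Dec j) ≤ ENNReal.ofReal lam₂) := by
  intro R hR lam₁ lam₂ h₁ h₂
  -- rate parameters
  obtain ⟨r, θ, hr0, hr4, hθ0, hθ2, hrate⟩ : ∃ r θ : ℝ, 0 < r ∧ r < 1 / 4 ∧ 0 < θ ∧ 2 * θ < 1 ∧
      0 < r * (1 - 2 * θ) - R := by
    have a1 : (0 : ℝ) < max R (1 / 8) := lt_max_of_lt_right (by norm_num)
    have a2 : max R (1 / 8) < (1 / 4 : ℝ) := max_lt hR (by norm_num)
    have a3 : R ≤ max R (1 / 8) := le_max_left _ _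
    generalize max R (1 / 8) = P at a1 a2 a3
    refine ⟨(P + 1 / 4) / 2, (1 / 4 - P) / 2, by linarith, by linarith, by linarith, by linarith, ?_⟩
    nlinarith
  -- channel constants
  set c := erfc (L_R / (2 * Real.sqrt D)) with hc
  have hc0 : 0 < c := erfc_pos _
  have hM0 : 0 < erfc 0 := erfc_pos 0
  set M := erfc 0 * A with hM
  set V := 24 * rexp (M + 1) * rexp (M * rexp 1) with hV
  have hV0 : 0 < V := by positivity
  set lam := min lam₁ lam₂ with hlam
  have hlam0 : 0 < lam := lt_min h₁.1 h₂.1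
  set K := Real.sqrt (V / lam) with hK
  have hK0 : 0 < K := Real.sqrt_pos.2 (by positivity)
  have hK2 : K ^ 2 = V / lam := Real.sq_sqrt (by positivity)
  obtain ⟨n1, hn1⟩ := ev_rpow (1 / 2 - 2 * r) (8 * K / (c ^ 2 * A ^ 2 * θ)) (by linarith)
  obtain ⟨n2, hn2⟩ := ev_rpow (r * (1 - 2 * θ) - R) 2 hrate
  obtain ⟨n3, hn3⟩ := exists_nat_ge (1 / θ)
  refine ⟨max (max n1 n2) (max n3 2), fun n hn => ?_⟩
  have hn1 := hn1 n (by omega)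
  have hn2 := hn2 n (by omega)
  have hn3 : 1 / θ ≤ n := hn3.trans (by exact_mod_cast (by omega : n3 ≤ n))
  have hn4 : 2 ≤ n := by omega
  have hn0 : (0 : ℝ) < n := by positivity
  have hn1' : (1 : ℝ) ≤ n := by exact_mod_cast (by omega : 1 ≤ n)
  rw [div_le_iff₀ hθ0] at hn3
  set q := ⌈(n : ℝ) ^ r⌉₊ with hq
  set d := ⌈θ * n⌉₊ with hd
  have hnr : 1 ≤ (n : ℝ) ^ r := Real.one_le_rpow hn1' hr0.le
  have hq1 : (n : ℝ) ^ r ≤ q := Nat.le_ceil _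
  have hq2 : (q : ℝ) ≤ 2 * (n : ℝ) ^ r := by
    have := Nat.ceil_lt_add_one (a := (n : ℝ) ^ r) (by positivity)
    linarith
  have hq0' : (0 : ℝ) < q := by linarith
  have hq0 : 0 < q := by exact_mod_cast hq0'
  have hd1 : θ * n ≤ d := Nat.le_ceil _
  have hd2 : (d : ℝ) ≤ 2 * θ * n := by
    have := Nat.ceil_lt_add_one (a := θ * n) (by positivity)
    linarith
  obtain ⟨C, hC1, hC2⟩ := gv n q d hq0
  set T := K * Real.sqrt n with hT
  have hT0 : 0 < T := mul_pos hK0 (Real.sqrt_pos.2 hn0)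
  have hTd : n * V / T ^ 2 = lam := by
    rw [hT, mul_pow, Real.sq_sqrt hn0.le, hK2]; field_simp
  have hsep : 2 * T ≤ c ^ 2 * (A / q) ^ 2 * d := by
    rw [div_le_iff₀ (by positivity)] at hn1
    have e1 : (n : ℝ) ^ (1 / 2 - 2 * r) * ((n : ℝ) ^ r) ^ 2 = Real.sqrt n := by
      rw [← Real.rpow_natCast, ← Real.rpow_mul hn0.le, ← Real.rpow_add hn0, Real.sqrt_eq_rpow]
      congr 1; push_cast; ring
    have e2 : Real.sqrt n * Real.sqrt n = n := Real.mul_self_sqrt hn0.le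
    have e3 : c ^ 2 * (A / q) ^ 2 * d = c ^ 2 * A ^ 2 * d / q ^ 2 := by field_simp
    rw [e3, le_div_iff₀ (by positivity)]
    calc 2 * T * (q : ℝ) ^ 2 ≤ 2 * T * (2 * (n : ℝ) ^ r) ^ 2 := by gcongr
      _ = (8 * K) * (Real.sqrt n * ((n : ℝ) ^ r) ^ 2) := by rw [hT]; ring
      _ ≤ ((n : ℝ) ^ (1 / 2 - 2 * r) * (c ^ 2 * A ^ 2 * θ)) * (Real.sqrt n * ((n : ℝ) ^ r) ^ 2) := by gcongr
      _ = c ^ 2 * A ^ 2 * (θ * (Real.sqrt n * ((n : ℝ) ^ (1 / 2 - 2 * r) * ((n : ℝ) ^ r) ^ 2))) := by ring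
      _ = c ^ 2 * A ^ 2 * (θ * n) := by rw [e1, e2]
      _ ≤ _ := by gcongr
  let g : Fin n → ℝ := fun t => absorbProb D L_R t
  have hg : ∀ t, c ≤ g t := fun t => (absorb_bounds D L_R hD hL t).1
  have hg' : ∀ t, g t ≤ erfc 0 := fun t => (absorb_bounds D L_R hD hL t).2
  have hgp : ∀ t, 0 ≤ g t := fun t => hc0.le.trans (hg t)
  let w : Fin C.card → Fin n → Fin q := fun i => (C.equivFin.symm i : Fin n → Fin q)
  let u : Fin C.card → Fin n → ℝ := fun i t => A * ((w i t : ℕ) : ℝ) / q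
  have hu : ∀ i t, u i t ∈ Set.Icc 0 A := by
    intro i t
    refine ⟨by positivity, ?_⟩
    rw [div_le_iff₀ hq0']
    have : ((w i t : ℕ) : ℝ) ≤ q := by exact_mod_cast (w i t).2.le
    gcongr
  have hν0 : ∀ i t, 0 ≤ g t * u i t := fun i t => mul_nonneg (hgp t) (hu i t).1
  have hνM : ∀ i t, g t * u i t ≤ M := fun i t => mul_le_mul (hg' t) (hu i t).2 (hu i t).1 hM0.le
  have hcheb : ∀ i j, channelOutput D L_R (u i)
      {y | T ≤ |(∑ t, stat (g t * u j t) (y t)) - ∑ t, (g t * u i t - g t * u j t) ^ 2|} ≤ ENNReal.ofReal lam := by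
    intro i j
    have := cheb (fun t => (g t * u i t).toNNReal) (fun t => g t * u j t) M T hT0 (hν0 j) (hνM j)
      (fun t => by rw [Real.coe_toNNReal _ (hν0 i t)]; exact hνM i t)
    simp only [Real.coe_toNNReal _ (hν0 i _)] at this
    rw [← hV, hTd] at this
    exact this
  refine ⟨C.card, u, fun j => {y | |∑ t, stat (g t * u j t) (y t)| < T}, ?_, hu, ?_, ?_⟩
  · exact size_bound n C.card q d R r θ hn4 hr0 hθ0 hθ2 hq1 hd2 hC2 hn2
  · intro i
    refine le_trans (measure_mono ?_) ((hcheb i i).trans (ENNReal.ofReal_le_ofReal (min_le_left _ _)))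
    intro y hy
    simpa using hy
  · intro i j hij
    refine le_trans (measure_mono ?_) ((hcheb i j).trans (ENNReal.ofReal_le_ofReal (min_le_right _ _)))
    intro y hy
    have hne : w i ≠ w j := fun h => hij (C.equivFin.symm.injective (Subtype.ext h))
    have hs := sep_bound hq0 A c hA hc0 g hg (w i) (w j)
      (hC1 _ (C.equivFin.symm i).2 _ (C.equivFin.symm j).2 hne)
    have hs' : 2 * T ≤ ∑ t, (g t * u i t - g t * u j t) ^ 2 := hsep.trans hs
    simp only [Set.mem_setOf_eq] at hy ⊢
    rw [abs_lt] at hy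
    rw [abs_sub_comm]
    exact le_trans (by linarith) (le_abs_self _)
end

section
/- Fix A > 0, a > 0, c ∈ (0,2), b ∈ (0,1], and ε ∈ (0,1], and for each n let δ_n = a·c·ε²·n^{(b−1)/2}. Suppose for each n that Y_1, …, Y_n are independent Poisson random variables with means λ_t = λ̃_t u_t, where ε ≤ λ̃_t ≤ 1 and 0 ≤ u_t ≤ A. Then P( | (1/n) Σ_{t=1}^n [ (Y_t − λ_t)² − Y_t ] | > δ_n ) ≤ 2A²/(a² c² ε⁴ n^b), which tends to 0 as n → ∞; i.e., the Type I error of the distance decoder vanishes as the block length grows. -/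
open MeasureTheory ProbabilityTheory Filter
open scoped ENNReal

lemma aux_stein (r : NNReal) (g : ℕ → ℝ) (s : ℝ)
    (h : HasSum (fun n : ℕ => Real.exp (-r) * (r:ℝ) ^ n / (n.factorial : ℝ) * g (n + 1)) s) :
    HasSum (fun n : ℕ => Real.exp (-r) * (r:ℝ) ^ n / (n.factorial : ℝ) * ((n:ℝ) * g n)) (r * s) := by
  rw [← hasSum_nat_add_iff' 1]
  simp only [Finset.range_one, Finset.sum_singleton, Nat.cast_zero, zero_mul, mul_zero, sub_zero]
  convert! h.mul_left (r:ℝ) using 1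
  funext n
  rw [Nat.factorial_succ]
  have : (n.factorial : ℝ) ≠ 0 := by positivity
  have : (n : ℝ) + 1 ≠ 0 := by positivity
  push_cast
  field_simp
  ring

lemma aux_moments (r : NNReal) :
    HasSum (fun n : ℕ => Real.exp (-r) * (r:ℝ) ^ n / (n.factorial : ℝ) *
      (((n:ℝ) - r) ^ 2 - n)) 0 ∧
    HasSum (fun n : ℕ => Real.exp (-r) * (r:ℝ) ^ n / (n.factorial : ℝ) *
      (((n:ℝ) - r) ^ 2 - n) ^ 2) (2 * (r:ℝ) ^ 2) := by
  have h0 := hasSum_one_poissonMeasure r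
  have h1 := aux_stein r (fun _ => 1) 1 (by simpa using h0)
  have h2 := aux_stein r (fun n => (n:ℝ) - 1) _ (by convert h1 using 3; push_cast; ring)
  have h3 := aux_stein r (fun n => ((n:ℝ) - 1) * (n - 2)) _ (by convert h2 using 3; push_cast; ring)
  have h4 := aux_stein r (fun n => ((n:ℝ) - 1) * ((n - 2) * (n - 3))) _
    (by convert h3 using 3; push_cast; ring)
  constructor
  · convert! (h2.sub (h1.mul_left (2 * (r:ℝ)))).add (h0.mul_left ((r:ℝ)^2)) using 1
    · funext n; ring
    · ring
  · convert! ((((h4.add (h3.mul_left (4 - 4 * (r:ℝ)))).add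
      (h2.mul_left (2 + 6 * (r:ℝ)^2 - 8 * r))).add
      (h1.mul_left (4 * (r:ℝ)^2 - 4 * (r:ℝ)^3))).add (h0.mul_left ((r:ℝ)^4))) using 1
    · funext n; ring
    · ring

lemma aux_memLp (r : NNReal) :
    MemLp (fun n : ℕ => ((n:ℝ) - r) ^ 2 - n) 2 (poissonMeasure r) := by
  rw [memLp_two_iff_integrable_sq (by fun_prop), integrable_poissonMeasure_iff]
  simpa using (aux_moments r).2.summable

lemma aux_mean (r : NNReal) :
    ∫ n : ℕ, (((n:ℝ) - r) ^ 2 - n) ∂(poissonMeasure r) = 0 := by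
  rw [integral_poissonMeasure]
  exact (aux_moments r).1.tsum_eq

lemma aux_var (r : NNReal) :
    Var[fun n : ℕ => ((n:ℝ) - r) ^ 2 - n; poissonMeasure r] = 2 * (r:ℝ) ^ 2 := by
  rw [variance_of_integral_eq_zero (by fun_prop) (aux_mean r), integral_poissonMeasure]
  exact (aux_moments r).2.tsum_eq

lemma aux_cheb (n : ℕ) (l : Fin n → NNReal) (A d : ℝ) (hl : ∀ t, (l t : ℝ) ≤ A)
    (hn : 0 < n) (hd : 0 < d) :
    (Measure.pi (fun t : Fin n => poissonMeasure (l t)))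
      {y : Fin n → ℕ | d < |(1 / (n : ℝ)) * ∑ t : Fin n, (((y t : ℝ) - l t) ^ 2 - (y t : ℝ))|} ≤
    ENNReal.ofReal (2 * A ^ 2 / (n * d ^ 2)) := by
  set μ := Measure.pi (fun t : Fin n => poissonMeasure (l t)) with hμ
  set X : Fin n → ℕ → ℝ := fun t k => ((k:ℝ) - l t) ^ 2 - k with hX
  have hm : ∀ t, MemLp (fun y : Fin n → ℕ => X t (y t)) 2 μ := fun t =>
    (aux_memLp (l t)).comp_measurePreserving (measurePreserving_eval _ t)
  have hmem : MemLp (∑ t, fun y : Fin n → ℕ => X t (y t)) 2 μ :=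
    memLp_finsetSum' _ (fun t _ => hm t)
  have hvar := variance_sum_pi (X := X) (fun t => aux_memLp (l t))
  have hmean : μ[∑ t, fun y : Fin n → ℕ => X t (y t)] = 0 := by
    simp only [Finset.sum_apply]
    rw [integral_finsetSum _ (fun t _ => (hm t).integrable (by norm_num))]
    refine Finset.sum_eq_zero fun t _ => ?_
    rw [hμ, integral_comp_eval (X := fun _ : Fin n => ℕ) (μ := fun t => poissonMeasure (l t)) (i := t) (f := X t) (by fun_prop)]
    exact aux_mean (l t)
  have hn' : (0:ℝ) < n := by exact_mod_cast hn
  have hch := meas_ge_le_variance_div_sq hmem (mul_pos hn' hd)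
  rw [hmean, hvar] at hch
  refine (measure_mono ?_).trans (hch.trans (ENNReal.ofReal_le_ofReal ?_))
  · intro y hy
    simp only [Set.mem_setOf_eq, abs_mul, abs_of_pos (one_div_pos.2 hn'), sub_zero,
      Finset.sum_apply] at hy ⊢
    rw [one_div, inv_mul_eq_div, lt_div_iff₀ hn'] at hy
    linarith
  · have : ∑ t, Var[X t; poissonMeasure (l t)] ≤ n * (2 * A ^ 2) := by
      calc _ ≤ ∑ t : Fin n, 2 * A ^ 2 := by
            refine Finset.sum_le_sum fun t _ => ?_
            rw [aux_var]
            have := hl t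
            have := (l t).coe_nonneg
            gcongr
        _ = _ := by simp
    calc _ ≤ n * (2 * A ^ 2) / (n * d) ^ 2 := by gcongr
      _ = _ := by field_simp

/-- **Vanishing Type I error of the distance decoder.**
Fix `A > 0`, `a > 0`, `c ∈ (0,2)`, `b ∈ (0,1]`, `ε ∈ (0,1]`, and set
`δ_n = a·c·ε²·n^{(b−1)/2}`. For each `n`, if `Y_1, …, Y_n` are independent with
`Y_t ~ Poisson(λ̃_t u_t)` (joint law the product of Poisson measures), where `ε ≤ λ̃_t ≤ 1`
and `0 ≤ u_t ≤ A`, then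
`P( |(1/n) Σ_t [(Y_t − λ̃_t u_t)² − Y_t]| > δ_n ) ≤ 2A²/(a²c²ε⁴ n^b)`, a bound that tends
to `0` as `n → ∞`. -/
theorem type_one_error_vanishes (A a c b ε : ℝ) (hA : 0 < A) (ha : 0 < a)
    (hc : c ∈ Set.Ioo (0 : ℝ) 2) (hb : b ∈ Set.Ioc (0 : ℝ) 1) (hε : ε ∈ Set.Ioc (0 : ℝ) 1) :
    (∀ (n : ℕ) (lamTilde u : Fin n → ℝ),
      (∀ t, lamTilde t ∈ Set.Icc ε 1) → (∀ t, u t ∈ Set.Icc 0 A) →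
      (Measure.pi (fun t : Fin n => poissonMeasure (lamTilde t * u t).toNNReal))
          {y : Fin n → ℕ |
            a * c * ε ^ 2 * (n : ℝ) ^ ((b - 1) / 2) <
              |(1 / (n : ℝ)) * ∑ t : Fin n,
                (((y t : ℝ) - lamTilde t * u t) ^ 2 - (y t : ℝ))|} ≤
        ENNReal.ofReal (2 * A ^ 2 / (a ^ 2 * c ^ 2 * ε ^ 4 * (n : ℝ) ^ b))) ∧
    Tendsto (fun n : ℕ => 2 * A ^ 2 / (a ^ 2 * c ^ 2 * ε ^ 4 * (n : ℝ) ^ b)) atTop (nhds 0) := by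
  obtain ⟨hc0, hc2⟩ := hc
  obtain ⟨hb0, hb1⟩ := hb
  obtain ⟨he0, he1⟩ := hε
  constructor
  · intro n lamTilde u hlam hu
    rcases Nat.eq_zero_or_pos n with rfl | hn
    · have : ∀ x : ℝ, 0 ≤ x → ¬ (a * c * ε ^ 2 * x < 0) := fun x hx => not_lt.2 (by positivity)
      simp [this _ (Real.rpow_nonneg le_rfl _)]
    have hn' : (0:ℝ) < n := by exact_mod_cast hn
    have hnn : ∀ t, 0 ≤ lamTilde t * u t := fun t =>
      mul_nonneg (he0.le.trans (hlam t).1) (hu t).1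
    have hle : ∀ t, ((lamTilde t * u t).toNNReal : ℝ) ≤ A := fun t => by
      rw [Real.coe_toNNReal _ (hnn t)]
      have := mul_le_mul (hlam t).2 (hu t).2 (hu t).1 zero_le_one
      linarith
    have key := aux_cheb n (fun t => (lamTilde t * u t).toNNReal) A
      (a * c * ε ^ 2 * (n : ℝ) ^ ((b - 1) / 2)) hle hn (by positivity)
    simp only [Real.coe_toNNReal _ (hnn _)] at key
    refine key.trans (le_of_eq ?_)
    congr 2
    have e1 : ((n:ℝ) ^ ((b - 1) / 2)) ^ 2 = (n:ℝ) ^ (b - 1) := by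
      rw [← Real.rpow_natCast, ← Real.rpow_mul hn'.le]
      congr 1
      push_cast
      ring
    have e2 : (n:ℝ) ^ b = n * (n:ℝ) ^ (b - 1) := by
      rw [Real.rpow_sub_one hn'.ne']
      field_simp
    rw [mul_pow, e1, e2]
    ring
  · refine Tendsto.const_div_atTop ?_ _
    refine Tendsto.const_mul_atTop (by positivity) ?_
    exact (tendsto_rpow_atTop hb0).comp tendsto_natCast_atTop_atTop
end

section
/- Fix A > 0, a > 0, c ∈ (0,2), b ∈ (0,1], and ε ∈ (0,1], set r₀(n) = √a·n^{(1+b)/4} and δ_n = a·c·ε²·n^{(b−1)/2}. For every λ₂ > 0 there exists n₀ such that for all n ≥ n₀ the following holds: for any two codewords u, v ∈ [0,A]^n with Euclidean distance ‖u − v‖ ≥ 2r₀(n), and any absorbing probabilities λ̃_1,…,λ̃_n ∈ [ε,1], if Y_1, …, Y_n are independent with Y_t ~ Poisson(λ̃_t u_t), then P( | (1/n) Σ_{t=1}^n [ (Y_t − λ̃_t v_t)² − Y_t ] | ≤ δ_n ) ≤ λ₂; i.e., the Type II error of the distance decoder between any two codewords at packing distance 2r₀ vanishes uniformly as the block length grows.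 -/
open MeasureTheory ProbabilityTheory
open scoped ENNReal

lemma po_hasSum (r : NNReal) (k : ℕ) :
    HasSum (fun n : ℕ ↦ (Real.exp (-r) * (r:ℝ) ^ n / (n.factorial:ℝ)) * (n.descFactorial k : ℝ)) ((r:ℝ)^k) := by
  rw [← hasSum_nat_add_iff' k]
  have h0 : ∑ i ∈ Finset.range k, (Real.exp (-r) * (r:ℝ) ^ i / (i.factorial:ℝ)) * (i.descFactorial k : ℝ) = 0 := by
    apply Finset.sum_eq_zero
    intro i hi
    rw [Nat.descFactorial_of_lt (Finset.mem_range.1 hi)]; simp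
  rw [h0, sub_zero]
  have := (hasSum_one_poissonMeasure r).mul_right ((r:ℝ)^k)
  rw [one_mul] at this
  convert! this using 2 with n
  have e : ((n+k).factorial:ℝ) = n.factorial * (n+k).descFactorial k := by
    have := Nat.factorial_mul_descFactorial (Nat.le_add_left k n)
    rw [Nat.add_sub_cancel] at this
    exact_mod_cast this.symm
  have h1 : (n.factorial:ℝ) ≠ 0 := by positivity
  have h2 : ((n+k).descFactorial k:ℝ) ≠ 0 := by
    have : (n+k).descFactorial k ≠ 0 := by
      rw [Ne, Nat.descFactorial_eq_zero_iff_lt]; omega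
    exact_mod_cast this
  rw [e, pow_add]
  field_simp

lemma po_int (r : NNReal) (k : ℕ) : ∫ n : ℕ, (n.descFactorial k : ℝ) ∂poissonMeasure r = (r:ℝ)^k := by
  rw [integral_poissonMeasure]
  simpa using (po_hasSum r k).tsum_eq

lemma po_exp_hasSum (r : NNReal) :
    HasSum (fun n : ℕ ↦ (Real.exp (-r) * (r:ℝ) ^ n / (n.factorial:ℝ)) * Real.exp n) (Real.exp (r * (Real.exp 1 - 1))) := by
  have := (NormedSpace.expSeries_div_hasSum_exp ((r : ℝ) * Real.exp 1)).mul_left (Real.exp (-r))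
  convert! this using 1
  · ext n
    rw [mul_pow, ← Real.exp_nat_mul, mul_one]; ring
  · rw [← Real.exp_eq_exp_ℝ, ← Real.exp_add]; ring_nf

lemma po_exp_integrable (r : NNReal) : Integrable (fun n : ℕ ↦ Real.exp n) (poissonMeasure r) := by
  rw [integrable_poissonMeasure_iff]
  simpa using (po_exp_hasSum r).summable

lemma po_exp_int_s9 (r : NNReal) : ∫ n : ℕ, Real.exp n ∂poissonMeasure r = Real.exp (r * (Real.exp 1 - 1)) := by
  rw [integral_poissonMeasure]
  simpa using (po_exp_hasSum r).tsum_eq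

lemma f_sq_le (A s : ℝ) (hs : s ∈ Set.Icc 0 A) (n : ℕ) :
    (((n:ℝ) - s)^2 - n)^2 ≤ (3*(24 + 2*(2*A+1)^2 + A^4)) * Real.exp n := by
  have h4 := Real.pow_div_factorial_le_exp (n:ℝ) (by positivity) 4
  have h2 := Real.pow_div_factorial_le_exp (n:ℝ) (by positivity) 2
  have h0 : 1 ≤ Real.exp n := Real.one_le_exp (by positivity)
  norm_num [Nat.factorial] at h4 h2
  obtain ⟨hs0, hs1⟩ := hs
  have e1 : (((n:ℝ) - s)^2 - n)^2 ≤ 3*((n:ℝ)^4 + (2*s+1)^2*n^2 + s^4) := by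
    have : ((n:ℝ) - s)^2 - n = n^2 - (2*s+1)*n + s^2 := by ring
    rw [this]
    nlinarith [sq_nonneg ((n:ℝ)^2 + (2*s+1)*n), sq_nonneg ((n:ℝ)^2 - s^2), sq_nonneg ((2*s+1)*n + s^2)]
  have e2 : (2*s+1)^2*(n:ℝ)^2 ≤ (2*A+1)^2*(2*Real.exp n) := by gcongr; linarith
  have e3 : s^4 ≤ A^4 * Real.exp n := by
    calc s^4 ≤ A^4 * 1 := by rw [mul_one]; gcongr
      _ ≤ _ := by gcongr
  linarith

lemma f_memLp (r : NNReal) (A s : ℝ) (hs : s ∈ Set.Icc 0 A) :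
    MemLp (fun n : ℕ ↦ ((n:ℝ) - s)^2 - n) 2 (poissonMeasure r) := by
  rw [memLp_two_iff_integrable_sq .of_discrete]
  refine ((po_exp_integrable r).const_mul (3*(24 + 2*(2*A+1)^2 + A^4))).mono' .of_discrete (.of_forall fun n ↦ ?_)
  rw [Real.norm_of_nonneg (sq_nonneg _)]
  exact f_sq_le A s hs n

lemma f_mean (r : NNReal) (s : ℝ) :
    ∫ n : ℕ, (((n:ℝ) - s)^2 - n) ∂poissonMeasure r = (r - s)^2 := by
  have i (k : ℕ) : Integrable (fun n : ℕ ↦ (n.descFactorial k : ℝ)) (poissonMeasure r) := by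
    rw [integrable_poissonMeasure_iff]
    simpa using (po_hasSum r k).summable
  have e : (fun n : ℕ ↦ ((n:ℝ) - s)^2 - n) = fun n : ℕ ↦ (n.descFactorial 2 : ℝ) - 2*s*(n.descFactorial 1 : ℝ) + s^2 := by
    ext n
    have : (n.descFactorial 2 : ℝ) = n * (n - 1) := Nat.cast_descFactorial_two ℝ n
    rw [this, Nat.descFactorial_one]; ring
  rw [e, integral_add (f := fun n : ℕ ↦ (n.descFactorial 2 : ℝ) - 2*s*(n.descFactorial 1 : ℝ)) ((i 2).sub ((i 1).const_mul _)) (integrable_const _), integral_sub (i 2) ((i 1).const_mul _), integral_const_mul, po_int, po_int]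
  simp; ring

lemma f_var (r : NNReal) (A s : ℝ) (hs : s ∈ Set.Icc 0 A) (hr : r ≤ A) :
    variance (fun n : ℕ ↦ ((n:ℝ) - s)^2 - n) (poissonMeasure r) ≤ (3*(24 + 2*(2*A+1)^2 + A^4)) * Real.exp (A * (Real.exp 1 - 1)) := by
  have := variance_le_expectation_sq (μ := poissonMeasure r) (X := (fun n : ℕ ↦ ((n:ℝ) - s)^2 - n)) .of_discrete
  refine this.trans ?_
  have h := integral_mono (μ := poissonMeasure r) ((memLp_two_iff_integrable_sq .of_discrete).1 (f_memLp r A s hs)) ((po_exp_integrable r).const_mul (3*(24 + 2*(2*A+1)^2 + A^4))) (f_sq_le A s hs)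
  rw [integral_const_mul, po_exp_int_s9] at h
  refine h.trans ?_
  have : 0 ≤ Real.exp 1 - 1 := by linarith [Real.add_one_le_exp 1]
  gcongr

/-- **Vanishing Type II error of the distance decoder at packing distance `2 r₀`.**
Fix `A > 0`, `a > 0`, `c ∈ (0,2)`, `b ∈ (0,1]`, `ε ∈ (0,1]`, and set
`r₀(n) = √a·n^{(1+b)/4}` and `δ_n = a·c·ε²·n^{(b−1)/2}`. For every `λ₂ > 0` there exists
`n₀` such that for all `n ≥ n₀`: for any codewords `u, v ∈ [0,A]^n` with Euclidean distance
`‖u − v‖ ≥ 2 r₀(n)` and any absorbing probabilities `λ̃_t ∈ [ε,1]`, if `Y_1, …, Y_n` are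
independent with `Y_t ~ Poisson(λ̃_t u_t)` (joint law the product of Poisson measures), then
`P( |(1/n) Σ_t [(Y_t − λ̃_t v_t)² − Y_t]| ≤ δ_n ) ≤ λ₂`. -/
theorem type_two_error_vanishes (A a c b ε : ℝ) (hA : 0 < A) (ha : 0 < a)
    (hc : c ∈ Set.Ioo (0 : ℝ) 2) (hb : b ∈ Set.Ioc (0 : ℝ) 1) (hε : ε ∈ Set.Ioc (0 : ℝ) 1) :
    ∀ lam₂ : ℝ, 0 < lam₂ →
      ∃ n₀ : ℕ, ∀ n ≥ n₀, ∀ u v : Fin n → ℝ,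
        (∀ t, u t ∈ Set.Icc 0 A) → (∀ t, v t ∈ Set.Icc 0 A) →
        2 * (Real.sqrt a * (n : ℝ) ^ ((1 + b) / 4)) ≤
          Real.sqrt (∑ t : Fin n, (u t - v t) ^ 2) →
        ∀ lamTilde : Fin n → ℝ, (∀ t, lamTilde t ∈ Set.Icc ε 1) →
          (Measure.pi (fun t : Fin n => poissonMeasure (lamTilde t * u t).toNNReal))
              {y : Fin n → ℕ |
                |(1 / (n : ℝ)) * ∑ t : Fin n,
                    (((y t : ℝ) - lamTilde t * v t) ^ 2 - (y t : ℝ))| ≤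
                  a * c * ε ^ 2 * (n : ℝ) ^ ((b - 1) / 2)} ≤
            ENNReal.ofReal lam₂ := by
  intro lam₂ hlam
  obtain ⟨hc0, hc2⟩ := hc
  obtain ⟨hb0, hb1⟩ := hb
  obtain ⟨he0, he1⟩ := hε
  set K : ℝ := (3*(24 + 2*(2*A+1)^2 + A^4)) * Real.exp (A * (Real.exp 1 - 1)) with hK
  have hKpos : 0 < K := by positivity
  have htend : Filter.Tendsto (fun n : ℕ ↦ (n:ℝ) ^ b) Filter.atTop Filter.atTop :=
    (tendsto_rpow_atTop hb0).comp tendsto_natCast_atTop_atTop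
  obtain ⟨n₀, hn₀⟩ := Filter.eventually_atTop.1
    ((htend.eventually_ge_atTop (K / (4 * a^2 * ε^4 * lam₂))).and (Filter.eventually_ge_atTop 1))
  refine ⟨n₀, fun n hn u v hu hv huv l hl ↦ ?_⟩
  obtain ⟨hnb, hn1⟩ := hn₀ n hn
  have hnpos : (0:ℝ) < n := by exact_mod_cast hn1
  set N : ℝ := (n:ℝ) ^ ((1+b)/2) with hN
  have hNpos : 0 < N := Real.rpow_pos_of_pos hnpos _
  have hNsq : N^2 = n * (n:ℝ)^b := by
    rw [hN, ← Real.rpow_natCast, ← Real.rpow_mul hnpos.le]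
    have : (1+b)/2 * ((2:ℕ):ℝ) = 1 + b := by push_cast; ring
    rw [this, Real.rpow_add hnpos, Real.rpow_one]
  have hquart : ((n:ℝ) ^ ((1+b)/4))^2 = N := by
    rw [hN, ← Real.rpow_natCast, ← Real.rpow_mul hnpos.le]
    congr 1; push_cast; ring
  have hdel : (n:ℝ) * (n:ℝ) ^ ((b-1)/2) = N := by
    rw [hN]
    have : (1+b)/2 = 1 + (b-1)/2 := by ring
    rw [this, Real.rpow_add hnpos, Real.rpow_one]
  have hdist : 4 * a * N ≤ ∑ t, (u t - v t)^2 := by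
    have h0 : 0 ≤ ∑ t, (u t - v t)^2 := Finset.sum_nonneg fun t _ ↦ sq_nonneg _
    have h1 : (2 * (Real.sqrt a * (n : ℝ) ^ ((1 + b) / 4)))^2 ≤
        (Real.sqrt (∑ t : Fin n, (u t - v t) ^ 2))^2 := by gcongr
    rw [Real.sq_sqrt h0, mul_pow, mul_pow, hquart, Real.sq_sqrt ha.le] at h1
    linarith
  have hlpos : ∀ t, 0 < l t := fun t ↦ he0.trans_le (hl t).1
  have hru : ∀ t, ((l t * u t).toNNReal : ℝ) = l t * u t := fun t ↦
    Real.coe_toNNReal _ (mul_nonneg (hlpos t).le (hu t).1)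
  have hs : ∀ t, l t * v t ∈ Set.Icc 0 A := fun t ↦
    ⟨mul_nonneg (hlpos t).le (hv t).1, by nlinarith [(hl t).2, (hv t).1, (hv t).2]⟩
  have hr : ∀ t, ((l t * u t).toNNReal : ℝ) ≤ A := fun t ↦ by
    rw [hru]; nlinarith [(hl t).2, (hu t).1, (hu t).2]
  set X : Fin n → ℕ → ℝ := fun t y ↦ ((y:ℝ) - l t * v t)^2 - y with hX
  set μ : Fin n → Measure ℕ := fun t ↦ poissonMeasure (l t * u t).toNNReal with hμ
  have hLp : ∀ t, MemLp (X t) 2 (μ t) := fun t ↦ f_memLp _ A _ (hs t)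
  have hLp' : ∀ t, MemLp (fun ω : Fin n → ℕ ↦ X t (ω t)) 2 (Measure.pi μ) := fun t ↦
    (hLp t).comp_measurePreserving (measurePreserving_eval μ t)
  have hvar : variance (∑ t, fun ω : Fin n → ℕ ↦ X t (ω t)) (Measure.pi μ) ≤ n * K := by
    rw [variance_sum_pi hLp]
    calc _ ≤ ∑ t : Fin n, K := Finset.sum_le_sum fun t _ ↦ f_var _ A _ (hs t) (hr t)
      _ = n * K := by simp
  have hmean : 4 * a * ε^2 * N ≤ ∫ ω, (∑ t, fun ω : Fin n → ℕ ↦ X t (ω t)) ω ∂(Measure.pi μ) := by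
    have : ∫ ω, (∑ t, fun ω : Fin n → ℕ ↦ X t (ω t)) ω ∂(Measure.pi μ)
        = ∑ t, (l t * u t - l t * v t)^2 := by
      simp only [Finset.sum_apply]
      rw [integral_finsetSum _ fun t _ ↦ (hLp' t).integrable (by norm_num)]
      refine Finset.sum_congr rfl fun t _ ↦ ?_
      rw [integral_comp_eval (μ := μ) (f := X t) .of_discrete]
      rw [hX, hμ]
      simp only
      rw [f_mean, hru]
    rw [this]
    calc 4 * a * ε^2 * N = ε^2 * (4 * a * N) := by ring
      _ ≤ ε^2 * ∑ t, (u t - v t)^2 := by gcongr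
      _ = ∑ t, ε^2 * (u t - v t)^2 := Finset.mul_sum _ _ _
      _ ≤ _ := Finset.sum_le_sum fun t _ ↦ by
        rw [← mul_sub, mul_pow]
        have := (hl t).1
        gcongr
  have hD : 0 < 2 * a * ε^2 * N := by positivity
  have hcheb := meas_ge_le_variance_div_sq (memLp_finsetSum' Finset.univ fun t _ ↦ hLp' t) hD
  refine (measure_mono ?_).trans (hcheb.trans (ENNReal.ofReal_le_ofReal ?_))
  · intro y hy
    simp only [Set.mem_setOf_eq] at hy ⊢
    rw [abs_mul, abs_of_pos (by positivity), one_div, inv_mul_le_iff₀ hnpos] at hy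
    have h1 : ∑ t, X t (y t) ≤ a * c * ε^2 * N := by
      refine (le_abs_self _).trans (hy.trans (le_of_eq ?_))
      rw [← hdel]; ring
    have h2 : a * c * ε^2 * N ≤ 2 * a * ε^2 * N := by
      have : 0 ≤ a * ε^2 * N := by positivity
      nlinarith
    rw [le_abs]
    right
    rw [Finset.sum_apply]
    linarith
  · rw [div_le_iff₀ (by positivity)]
    refine hvar.trans ?_
    rw [div_le_iff₀ (by positivity)] at hnb
    have : lam₂ * (2 * a * ε^2 * N)^2 = n * ((n:ℝ)^b * (4 * a^2 * ε^4 * lam₂)) := by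
      rw [mul_pow, hNsq]; ring
    rw [this]
    gcongr
end

section
/- Fix A > 0, a > 0, b ∈ [0,1), and set r₀(n) = √a · n^{(1+b)/4}. For every R < (1−b)/4 there exists n₀ such that for all n ≥ n₀ there exist at least 2^{R · n · log₂ n} points in the cube [0,A]^n whose pairwise Euclidean distances are all at least 2r₀(n). -/
open Real

open MeasureTheory in
lemma aux_sep (n : ℕ) [Nonempty (Fin n)] (A d : ℝ) (hA : 0 < A) (hd : 0 < d) (k : ℕ)
    (hk : ∀ j < k, (j : ℝ) * (d ^ n * (√π ^ n / Real.Gamma ((n:ℝ) / 2 + 1))) < A ^ n) :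
    ∃ S : Finset (EuclideanSpace ℝ (Fin n)),
      (∀ x ∈ S, ∀ i, x i ∈ Set.Icc 0 A) ∧
      (∀ x ∈ S, ∀ y ∈ S, x ≠ y → d ≤ dist x y) ∧ S.card = k := by
  classical
  induction k with
  | zero => exact ⟨∅, by simp⟩
  | succ k ih =>
    obtain ⟨S, h1, h2, h3⟩ := ih (fun j hj => hk j (by omega))
    have hG : 0 < Real.Gamma ((n:ℝ) / 2 + 1) := Real.Gamma_pos_of_pos (by positivity)
    set Q : Set (EuclideanSpace ℝ (Fin n)) := {x | ∀ i, x i ∈ Set.Icc 0 A} with hQ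
    have hvol : volume Q = ENNReal.ofReal (A ^ n) := by
      have := (EuclideanSpace.volume_preserving_symm_measurableEquiv_toLp (Fin n)).measure_preimage_equiv
        (Set.Icc (0 : Fin n → ℝ) (fun _ => A))
      rw [Real.volume_Icc_pi] at this
      simp only [Pi.zero_apply, sub_zero, Finset.prod_const, Finset.card_univ, Fintype.card_fin] at this
      rw [ENNReal.ofReal_pow hA.le, ← this]
      congr 1
      ext x
      simp [hQ, Set.mem_Icc, Pi.le_def, forall_and]
    have hex : ∃ z ∈ Q, ∀ y ∈ S, d ≤ dist z y := by
      by_contra! hcon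
      have hsub : Q ⊆ ⋃ y ∈ S, Metric.ball y d := by
        intro z hz
        obtain ⟨y, hy, hlt⟩ := hcon z hz
        simp only [Set.mem_iUnion]
        exact ⟨y, hy, hlt⟩
      have hle := (measure_mono (μ := volume) hsub).trans (measure_biUnion_finset_le S _)
      simp only [EuclideanSpace.volume_ball, Finset.sum_const, h3, Fintype.card_fin, hvol, nsmul_eq_mul] at hle
      rw [← ENNReal.ofReal_pow hd.le, ← ENNReal.ofReal_mul (by positivity), ← ENNReal.ofReal_natCast,
        ← ENNReal.ofReal_mul (by positivity), ENNReal.ofReal_le_ofReal_iff (by positivity)] at hle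
      exact absurd (hk k (by omega)) (not_lt.2 hle)
    obtain ⟨z, hzQ, hz⟩ := hex
    have hzS : z ∉ S := fun h => by
      have := hz z h
      simp at this
      linarith
    refine ⟨insert z S, ?_, ?_, by rw [Finset.card_insert_of_notMem hzS, h3]⟩
    · intro x hx
      rcases Finset.mem_insert.1 hx with rfl | hx
      · exact hzQ
      · exact h1 x hx
    · intro x hx y hy hxy
      rcases Finset.mem_insert.1 hx with rfl | hx2 <;> rcases Finset.mem_insert.1 hy with rfl | hy2
      · exact absurd rfl hxy
      · exact hz y hy2
      · rw [dist_comm]; exact hz x hx2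
      · exact h2 x hx2 y hy2 hxy

open MeasureTheory in
lemma aux_gamma (s : ℝ) (hs : 0 < s) : s ^ s * Real.exp (-s) ≤ Real.Gamma (s + 1) := by
  rw [Real.Gamma_eq_integral (by linarith)]
  have hint := Real.GammaIntegral_convergent (s := s + 1) (by linarith)
  have hsub : Set.Ioi s ⊆ Set.Ioi 0 := Set.Ioi_subset_Ioi hs.le
  calc s ^ s * Real.exp (-s) = ∫ x in Set.Ioi s, s ^ s * Real.exp (-x) := by
        rw [integral_const_mul, integral_exp_neg_Ioi]
    _ ≤ ∫ x in Set.Ioi s, Real.exp (-x) * x ^ (s + 1 - 1) := by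
        apply setIntegral_mono_on
        · exact (integrableOn_exp_neg_Ioi s).const_mul _
        · exact hint.mono_set hsub
        · exact measurableSet_Ioi
        · intro x hx
          rw [mul_comm, add_sub_cancel_right]
          have hx' : s < x := hx
          gcongr
    _ ≤ _ := by
        apply setIntegral_mono_set hint
        · filter_upwards [ae_restrict_mem measurableSet_Ioi] with x hx
          have : (0:ℝ) < x := hx
          simp only [Pi.zero_apply]
          positivity
        · exact hsub.eventuallyLE

/-- **Codebook-size guarantee from sphere packing.**
Fix `A > 0`, `a > 0`, `b ∈ [0,1)`, and set `r₀(n) = √a · n^{(1+b)/4}`. For every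
`R < (1−b)/4` there exists `n₀` such that for all `n ≥ n₀` there are at least
`2^{R · n · log₂ n}` points in the cube `[0,A]^n ⊆ ℝ^n` (Euclidean norm) whose pairwise
distances are all at least `2 r₀(n)`. -/
theorem exists_large_codebook (A a b : ℝ) (hA : 0 < A) (ha : 0 < a)
    (hb : b ∈ Set.Ico (0 : ℝ) 1) :
    ∀ R : ℝ, R < (1 - b) / 4 →
      ∃ n₀ : ℕ, ∀ n ≥ n₀,
        ∃ S : Finset (EuclideanSpace ℝ (Fin n)),
          (∀ x ∈ S, ∀ i, x i ∈ Set.Icc 0 A) ∧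
          (∀ x ∈ S, ∀ y ∈ S, x ≠ y →
            2 * (Real.sqrt a * (n : ℝ) ^ ((1 + b) / 4)) ≤ dist x y) ∧
          (2 : ℝ) ^ (R * (n : ℝ) * Real.logb 2 (n : ℝ)) ≤ (S.card : ℝ) := by
  intro R hR
  have he : 0 < (1 - b) / 4 - R := by linarith
  set C : ℝ := A / (√(2 * Real.exp 1) * (2 * √a) * √π) with hC
  have hCpos : 0 < C := by have := Real.exp_pos 1; positivity
  have ht := ((tendsto_rpow_atTop he).comp tendsto_natCast_atTop_atTop).eventually_ge_atTop (C⁻¹)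
  obtain ⟨n₁, hn₁⟩ := Filter.eventually_atTop.1 ht
  refine ⟨max n₁ 1, fun n hn => ?_⟩
  have h1 : 1 ≤ n := le_trans (le_max_right _ _) hn
  have hbig := hn₁ n (le_trans (le_max_left _ _) hn)
  simp only [Function.comp] at hbig
  have : Nonempty (Fin n) := ⟨⟨0, h1⟩⟩
  have hn0 : (0:ℝ) < n := by exact_mod_cast h1
  have hG : 0 < Real.Gamma ((n:ℝ) / 2 + 1) := Real.Gamma_pos_of_pos (by positivity)
  set d : ℝ := 2 * (√a * (n:ℝ) ^ ((1 + b) / 4)) with hd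
  have hdpos : 0 < d := by positivity
  set V : ℝ := d ^ n * (√π ^ n / Real.Gamma ((n:ℝ) / 2 + 1)) with hV
  have hVpos : 0 < V := by positivity
  obtain ⟨S, hS1, hS2, hS3⟩ := aux_sep n A d hA hdpos ⌈A ^ n / V⌉₊ (fun j hj => by
    rw [Nat.lt_ceil, lt_div_iff₀ hVpos] at hj
    exact hj)
  refine ⟨S, hS1, hS2, ?_⟩
  rw [hS3]
  refine le_trans ?_ (Nat.le_ceil _)
  have hlhs : (2:ℝ) ^ (R * n * Real.logb 2 n) = ((n:ℝ) ^ R) ^ n := by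
    rw [mul_comm, Real.rpow_mul (by norm_num), Real.rpow_logb (by norm_num) (by norm_num) hn0,
      Real.rpow_mul hn0.le, Real.rpow_natCast]
  have hgam : (√n / √(2 * Real.exp 1)) ^ n ≤ Real.Gamma ((n:ℝ) / 2 + 1) := by
    refine le_trans (le_of_eq ?_) (aux_gamma ((n:ℝ) / 2) (by positivity))
    have hE : Real.exp (-((n:ℝ)/2)) = (Real.exp (-1)) ^ ((n:ℝ)/2) := by
      rw [← Real.exp_mul]; ring_nf
    rw [hE, ← Real.mul_rpow (by positivity) (by positivity), ← Real.sqrt_div hn0.le,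
      Real.sqrt_eq_rpow, ← Real.rpow_natCast, ← Real.rpow_mul (by positivity), Real.exp_neg]
    congr 1
    · field_simp
    · ring
  rw [hlhs, le_div_iff₀ hVpos, hV]
  have hroot : (n:ℝ) ^ R * (d * √π) ≤ A * (√n / √(2 * Real.exp 1)) := by
    have hs : √(n:ℝ) = (n:ℝ) ^ R * (n:ℝ) ^ ((1 + b) / 4) * (n:ℝ) ^ ((1 - b) / 4 - R) := by
      rw [Real.sqrt_eq_rpow, ← Real.rpow_add hn0, ← Real.rpow_add hn0]; ring_nf
    have hA' : A = C * (√(2 * Real.exp 1) * (2 * √a) * √π) := by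
      rw [hC]; have := Real.exp_pos 1; field_simp
    have h1C : 1 ≤ C * (n:ℝ) ^ ((1 - b) / 4 - R) := by
      rw [inv_le_iff_one_le_mul₀ hCpos] at hbig; linarith
    have hsq : √(2 * Real.exp 1) ≠ 0 := by have := Real.exp_pos 1; positivity
    calc (n:ℝ) ^ R * (d * √π) ≤ (n:ℝ) ^ R * (d * √π) * (C * (n:ℝ) ^ ((1 - b) / 4 - R)) :=
          le_mul_of_one_le_right (by positivity) h1C
      _ = A * (√n / √(2 * Real.exp 1)) := by
          rw [hs, hd]
          nth_rewrite 1 [hA']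
          field_simp
  have hpow := pow_le_pow_left₀ (by positivity) hroot n
  calc ((n:ℝ) ^ R) ^ n * (d ^ n * (√π ^ n / Real.Gamma ((n:ℝ) / 2 + 1)))
      = ((n:ℝ) ^ R * (d * √π)) ^ n / Real.Gamma ((n:ℝ) / 2 + 1) := by
        rw [mul_pow, mul_pow]; ring
    _ ≤ A ^ n := by
        rw [div_le_iff₀ hG]
        refine hpow.trans ?_
        rw [mul_pow]
        gcongr
end
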